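/- arXiv:2002.11920 — 8 statements merged into one kernel-verified Lean document; each statement's English description precedes it below -/
import Mathlib

section
/- Let R be a commutative ring and let a₀, a₁, a₂, μ, c ∈ R with μ² + μ + 1 = 0. Then in the polynomial ring R[X], the polynomial (a₀ + a₁μ²X + a₂μ⁴X²)·(a₀ + a₁μX + a₂μ²X²) − [(a₀² − a₁a₂c) + (a₂²c − a₀a₁)X + (a₁² − a₀a₂)X²] is divisible by X³ − c. -/
open Polynomial

theorem cyclotomic_inverse_coeff_formula_cubic (R : Type*) [CommRing R]
    (a₀ a₁ a₂ μ c : R) (hμ : μ ^ 2 + μ + 1 = 0) :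
    (X ^ 3 - C c : R[X]) ∣
      (C a₀ + C (a₁ * μ ^ 2) * X + C (a₂ * μ ^ 4) * X ^ 2) *
        (C a₀ + C (a₁ * μ) * X + C (a₂ * μ ^ 2) * X ^ 2) -
      (C (a₀ ^ 2 - a₁ * a₂ * c) + C (a₂ ^ 2 * c - a₀ * a₁) * X +
        C (a₁ ^ 2 - a₀ * a₂) * X ^ 2) := by
  have h : (C μ ^ 2 + C μ + 1 : R[X]) = 0 := by
    simpa using congrArg (C : R → R[X]) hμ
  refine ⟨C (a₂ ^ 2) * X - C (a₁ * a₂), ?_⟩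
  simp only [map_mul, map_pow, map_sub]
  linear_combination (C a₀ * C a₁ * X
    + (C a₀ * C a₂ * (C μ ^ 2 - C μ + 1) + C a₁ ^ 2 * (C μ - 1)) * X ^ 2
    + C a₁ * C a₂ * (C μ ^ 3 - C μ + 1) * X ^ 3
    + C a₂ ^ 2 * (C μ - 1) * (C μ ^ 3 + 1) * X ^ 4) * h
end

section
/- In the polynomial ring ℚ[x], with p(x) = ((x+1)² + ((x−1)²(2x³+1)²)/3)/4 and r(x) = (x⁶ + x³ + 1)/3, the polynomial r(x) divides p(x)⁶ + p(x)³ + 1; that is, there exists d(x) ∈ ℚ[x] with p(x)⁶ + p(x)³ + 1 = r(x)·d(x). -/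
open Polynomial

theorem k9_hard_part_divisibility :
    let p : ℚ[X] := C (1/4 : ℚ) * ((X + 1) ^ 2 + C (1/3 : ℚ) * ((X - 1) ^ 2 * (2 * X ^ 3 + 1) ^ 2))
    let r : ℚ[X] := C (1/3 : ℚ) * (X ^ 6 + X ^ 3 + 1)
    ∃ d : ℚ[X], p ^ 6 + p ^ 3 + 1 = r * d := by
  intro p r
  have h4 : C (1/4 : ℚ) * 4 = 1 := by
    rw [← map_ofNat C 4, ← C_mul, ← C_1]; norm_num
  have h3 : C (1/3 : ℚ) * 3 = 1 := by
    rw [← map_ofNat C 3, ← C_mul, ← C_1]; norm_num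
  -- `p ≡ X` modulo `r`, because `(2 * X ^ 3 + 1) ^ 2 = 4 * (X ^ 6 + X ^ 3 + 1) - 3`.
  have hp : p = X + r * (X - 1) ^ 2 := by
    simp only [p, r]
    linear_combination (X + C (1/3 : ℚ) * (X - 1) ^ 2 * (X ^ 6 + X ^ 3 + 1)) * h4
      - C (1/4 : ℚ) * (X - 1) ^ 2 * h3
  have hr : r * 3 = X ^ 6 + X ^ 3 + 1 := by
    simp only [r]
    linear_combination (X ^ 6 + X ^ 3 + 1) * h3
  refine ⟨(X - 1) ^ 2 * (p ^ 2 + p * X + X ^ 2) * (p ^ 3 + X ^ 3 + 1) + 3, ?_⟩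
  clear_value p r
  linear_combination (p ^ 2 + p * X + X ^ 2) * (p ^ 3 + X ^ 3 + 1) * hp - hr
end

section
/- In ℚ[x] let p(x) = ((x+1)² + ((x−1)²(2x³+1)²)/3)/4 and r(x) = (x⁶ + x³ + 1)/3, and define k₂ = −(x−1)², k₁ = x·k₂, k₀ = x·k₁, k₅ = −x·k₀, k₄ = x·k₅, k₃ = x·k₄ + 3. Then the identity x³·(p(x)⁶ + p(x)³ + 1) = r(x)·(k₀ + k₁·p(x) + k₂·p(x)² + k₃·p(x)³ + k₄·p(x)⁴ + k₅·p(x)⁵) holds in ℚ[x]. -/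
open Polynomial

theorem k9_final_exponentiation_decomposition
    (p r k₀ k₁ k₂ k₃ k₄ k₅ : ℚ[X])
    (hp : p = C (1/4 : ℚ) * ((X + 1) ^ 2 + C (1/3 : ℚ) * ((X - 1) ^ 2 * (2 * X ^ 3 + 1) ^ 2)))
    (hr : r = C (1/3 : ℚ) * (X ^ 6 + X ^ 3 + 1))
    (hk₂ : k₂ = -(X - 1) ^ 2) (hk₁ : k₁ = X * k₂) (hk₀ : k₀ = X * k₁)
    (hk₅ : k₅ = -(X * k₀)) (hk₄ : k₄ = X * k₅) (hk₃ : k₃ = X * k₄ + 3) :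
    X ^ 3 * (p ^ 6 + p ^ 3 + 1) =
      r * (k₀ + k₁ * p + k₂ * p ^ 2 + k₃ * p ^ 3 + k₄ * p ^ 4 + k₅ * p ^ 5) := by 
  have three_mul_C : (3 : ℚ[X]) * C (1 / 3 : ℚ) = 1 := by
    rw [← C_ofNat, ← C_mul]
    norm_num
  have four_mul_C : (4 : ℚ[X]) * C (1 / 4 : ℚ) = 1 := by
    rw [← C_ofNat, ← C_mul]
    norm_num
  have three_mul_r : 3 * r = X ^ 6 + X ^ 3 + 1 := by
    rw [hr]
    linear_combination (X ^ 6 + X ^ 3 + 1) * three_mul_C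
  have p_sub_X : p - X = (X - 1) ^ 2 * r := by
    rw [hp, hr]
    linear_combination (X + C (1 / 3 : ℚ) * (X - 1) ^ 2 * (X ^ 6 + X ^ 3 + 1)) * four_mul_C
      - C (1 / 4 : ℚ) * (X - 1) ^ 2 * three_mul_C
  subst hk₃ hk₄ hk₅ hk₀ hk₁ hk₂
  linear_combination (X ^ 2 + X * p + p ^ 2) * (X ^ 3 * p ^ 3 - 1) * p_sub_X - p ^ 3 * three_mul_r
end

section
/- In the polynomial ring ℚ[x], with p(x) = (x¹² − 2x¹¹ + x¹⁰ + x⁷ − 2x⁶ + x⁵ + x² + x + 1)/3 and r(x) = x⁸ − x⁷ + x⁵ − x⁴ + x³ − x + 1, the polynomial r(x) divides p(x)¹⁰ + p(x)⁵ + 1; that is, there exists d(x) ∈ ℚ[x] with p(x)¹⁰ + p(x)⁵ + 1 = r(x)·d(x). -/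
theorem fifteenth_cyclotomic_mul {R : Type*} [CommRing R] (x : R) :
    x ^ 10 + x ^ 5 + 1 = (x ^ 8 - x ^ 7 + x ^ 5 - x ^ 4 + x ^ 3 - x + 1) * (x ^ 2 + x + 1) := by
  ring

theorem dvd_pow_ten_add_pow_five_add_one_of_dvd_sub {R : Type*} [CommRing R] {r p x : R}
    (hp : r ∣ p - x) (hx : r ∣ x ^ 10 + x ^ 5 + 1) : r ∣ p ^ 10 + p ^ 5 + 1 := by
  have h := ((hp.trans (sub_dvd_pow_sub_pow p x 10)).add
    (hp.trans (sub_dvd_pow_sub_pow p x 5))).add hx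
  convert h using 1
  ring

open Polynomial

theorem k15_hard_part_divisibility :
    let p : ℚ[X] := C (1/3 : ℚ) *
      (X ^ 12 - 2 * X ^ 11 + X ^ 10 + X ^ 7 - 2 * X ^ 6 + X ^ 5 + X ^ 2 + X + 1)
    let r : ℚ[X] := X ^ 8 - X ^ 7 + X ^ 5 - X ^ 4 + X ^ 3 - X + 1
    ∃ d : ℚ[X], p ^ 10 + p ^ 5 + 1 = r * d := by
  intro p r
  have hx : r ∣ X ^ 10 + X ^ 5 + 1 := ⟨_, fifteenth_cyclotomic_mul X⟩
  refine dvd_pow_ten_add_pow_five_add_one_of_dvd_sub (x := X) ?_ hx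
  have h_third : (C (1/3 : ℚ) : ℚ[X]) * 3 = 1 := by
    rw [← C_ofNat, ← C_mul]
    norm_num
  have hp : p - X = C (1/3 : ℚ) * (X - 1) ^ 2 * (X ^ 10 + X ^ 5 + 1) := by
    linear_combination X * h_third
  rw [hp]
  exact hx.mul_left _
end

section
/- In ℚ[x] let p(x) = (x¹² − 2x¹¹ + x¹⁰ + x⁷ − 2x⁶ + x⁵ + x² + x + 1)/3 and r(x) = x⁸ − x⁷ + x⁵ − x⁴ + x³ − x + 1, and define k₂ = −(x−1)²(x²+x+1), k₁ = x·k₂, k₀ = x·k₁, k₉ = −x·k₀, k₈ = x·k₉, k₇ = x·k₈, k₆ = x·k₇, k₅ = x·k₆ + 3, M = k₂ + k₅ + k₈, k₄ = M − (k₁ + k₇), k₃ = M − (k₀ + k₆ + k₉). Then the identity 3x³·(p(x)¹⁰ + p(x)⁵ + 1) = r(x)·(k₀ + k₁·p(x) + k₂·p(x)² + k₃·p(x)³ + k₄·p(x)⁴ + k₅·p(x)⁵ + k₆·p(x)⁶ + k₇·p(x)⁷ + k₈·p(x)⁸ + k₉·p(x)⁹) holds in ℚ[x]. -/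
open Polynomial

theorem k15_final_exponentiation_decomposition
    (p r k₀ k₁ k₂ k₃ k₄ k₅ k₆ k₇ k₈ k₉ M : ℚ[X])
    (hp : p = C (1/3 : ℚ) *
      (X ^ 12 - 2 * X ^ 11 + X ^ 10 + X ^ 7 - 2 * X ^ 6 + X ^ 5 + X ^ 2 + X + 1))
    (hr : r = X ^ 8 - X ^ 7 + X ^ 5 - X ^ 4 + X ^ 3 - X + 1)
    (hk₂ : k₂ = -((X - 1) ^ 2 * (X ^ 2 + X + 1))) (hk₁ : k₁ = X * k₂) (hk₀ : k₀ = X * k₁)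
    (hk₉ : k₉ = -(X * k₀)) (hk₈ : k₈ = X * k₉) (hk₇ : k₇ = X * k₈) (hk₆ : k₆ = X * k₇)
    (hk₅ : k₅ = X * k₆ + 3) (hM : M = k₂ + k₅ + k₈)
    (hk₄ : k₄ = M - (k₁ + k₇)) (hk₃ : k₃ = M - (k₀ + k₆ + k₉)) :
    3 * X ^ 3 * (p ^ 10 + p ^ 5 + 1) =
      r * (k₀ + k₁ * p + k₂ * p ^ 2 + k₃ * p ^ 3 + k₄ * p ^ 4 + k₅ * p ^ 5 +
        k₆ * p ^ 6 + k₇ * p ^ 7 + k₈ * p ^ 8 + k₉ * p ^ 9) := by 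
  subst hM hk₄ hk₃ hk₅ hk₆ hk₇ hk₈ hk₉ hk₀ hk₁ hk₂ hr hp
  refine Polynomial.funext fun x => ?_
  simp only [eval_mul, eval_add, eval_sub, eval_neg, eval_pow, eval_X, eval_C, eval_one,
    eval_ofNat]
  ring
end

section
/- Let x₀ = 2⁴³ + 2³⁷ + 2⁷ + 1. Then r₀ = (x₀⁶ + x₀³ + 1)/3 is a prime number with 2²⁵⁶ ≤ r₀ < 2²⁵⁷, and p₀ = (3(x₀+1)² + (x₀−1)²(2x₀³+1)²)/12 is a prime number with 2³⁴² ≤ p₀ < 2³⁴³; moreover p₀ ≡ 1 (mod 6) and x₀ ≡ 1 (mod 6). -/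
namespace Nat

/-- **Pocklington's criterion**, in the form where the factored part `F` of `n - 1` satisfies
`n < F ^ 2`. -/
theorem prime_of_pocklington {n F : ℕ} (a : ℕ) (hn : 1 < n) (hF : F ∣ n - 1) (hnF : n < F * F)
    (ha : a ^ (n - 1) % n = 1)
    (h : ∀ l : ℕ, l.Prime → l ∣ F → Nat.Coprime (a ^ ((n - 1) / l) % n - 1) n) : n.Prime := by
  by_contra hnp
  set q := n.minFac with hq
  have hqp : q.Prime := Nat.minFac_prime hn.ne'
  have hqn : q ∣ n := Nat.minFac_dvd n
  have : Fact q.Prime := ⟨hqp⟩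
  have cast_mod (m : ℕ) : ((m % n : ℕ) : ZMod q) = m :=
    (ZMod.natCast_eq_natCast_iff _ _ _).2 ((Nat.mod_modEq m n).of_dvd hqn)
  obtain ⟨k, hk⟩ := hF
  have hF0 : 0 < F := by
    rcases Nat.eq_zero_or_pos F with rfl | h0
    · omega
    · exact h0
  have hpow : (a : ZMod q) ^ (n - 1) = 1 := by
    rw [← Nat.cast_pow, ← cast_mod, ha, Nat.cast_one]
  have hord : orderOf ((a : ZMod q) ^ k) = F := by
    refine orderOf_eq_of_pow_and_pow_div_prime hF0 ?_ fun l hl hlF hone => ?_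
    · rw [← pow_mul, mul_comm, ← hk, hpow]
    · obtain ⟨j, rfl⟩ := hlF
      have hdiv : (n - 1) / l = k * j := by
        rw [hk, mul_assoc, Nat.mul_div_cancel_left _ hl.pos, mul_comm]
      rw [Nat.mul_div_cancel_left _ hl.pos, ← pow_mul, ← hdiv, ← Nat.cast_pow, ← cast_mod] at hone
      have hdvd : q ∣ a ^ ((n - 1) / l) % n - 1 := by
        rcases Nat.eq_zero_or_pos (a ^ ((n - 1) / l) % n) with h0 | h0
        · simp [h0]
        · rw [← ZMod.natCast_eq_zero_iff, Nat.cast_sub h0, hone, Nat.cast_one, sub_self]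
      exact hqp.one_lt.ne' (Nat.dvd_one.1 (h l hl ⟨j, rfl⟩ ▸ Nat.dvd_gcd hdvd hqn))
  have hne : (a : ZMod q) ^ k ≠ 0 := fun h0 => by
    rw [hk, mul_comm, pow_mul, h0, zero_pow hF0.ne'] at hpow
    exact zero_ne_one hpow
  have hFq : F ≤ q - 1 :=
    hord ▸ Nat.le_of_dvd (Nat.sub_pos_of_lt hqp.one_lt) (ZMod.orderOf_dvd_card_sub_one hne)
  have hqq : q ^ 2 ≤ n := Nat.minFac_sq_le_self (by omega) hnp
  nlinarith [hqp.one_lt, Nat.sub_le q 1]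

/-- Application of a function to a natural number, arranged so that the kernel evaluates the
argument first. -/
def eager {α : Type*} (m : ℕ) (f : ℕ → α) : α :=
  Nat.casesOn m (f 0) fun k => f (k + 1)

theorem eager_eq {α : Type*} (m : ℕ) (f : ℕ → α) : eager m f = f m := by
  cases m <;> rfl

/-- Square-and-multiply modulo `n`, through the low `k` bits of `e`, starting from `c`. -/
def powMod (n a e : ℕ) : ℕ → ℕ → ℕ
  | 0, c => c % n
  | k + 1, c => eager (c * c % n * cond (e.testBit k) a 1 % n) (powMod n a e k)

theorem div_two_pow_eq_add_testBit (e k : ℕ) :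
    e / 2 ^ k = e / 2 ^ (k + 1) + e / 2 ^ (k + 1) + (e.testBit k).toNat := by
  rw [Nat.toNat_testBit, pow_succ, ← Nat.div_div_eq_div_mul]
  omega

theorem powMod_of_modEq {n a e : ℕ} (k : ℕ) {c : ℕ} (hc : c ≡ a ^ (e / 2 ^ k) [MOD n]) :
    powMod n a e k c = a ^ e % n := by
  induction k generalizing c with
  | zero => rwa [pow_zero, Nat.div_one] at hc
  | succ k ih =>
    rw [powMod, eager_eq]
    refine ih ((Nat.mod_modEq _ _).trans ?_)
    rw [div_two_pow_eq_add_testBit, pow_add, pow_add]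
    refine ((Nat.mod_modEq _ _).trans (hc.mul hc)).mul ?_
    cases e.testBit k
    · simpa using Nat.ModEq.refl 1
    · simpa using Nat.ModEq.refl a

theorem pow_mod_eq_powMod {n a e : ℕ} (k : ℕ) (he : e / 2 ^ k = 0) :
    a ^ e % n = powMod n a e k 1 :=
  (powMod_of_modEq k (by rw [he, pow_zero])).symm

end Nat

namespace WeierstrassCurve.Affine.Point

/-- A Weierstrass curve over a finite field has at most two points over each element of the
projective line. -/
theorem addOrderOf_le {K : Type*} [Field K] [Finite K] [DecidableEq K] {W : Affine K}
    (P : W.Point) : addOrderOf P ≤ 2 * (Nat.card K + 1) := by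
  classical
  have : Fintype K := Fintype.ofFinite K
  let x : W.Point → Option K
    | zero => none
    | some x _ _ => Option.some x
  have hx (P Q : W.Point) (h : x P = x Q) : P = Q ∨ P = -Q := by
    rcases P with _ | ⟨x₁, y₁, h₁⟩ <;> rcases Q with _ | ⟨x₂, y₂, h₂⟩
    · exact .inl rfl
    · simp [x] at h
    · simp [x] at h
    · exact X_eq_iff.1 (Option.some.inj h)
  have hfib (s : Finset W.Point) : s.card ≤ 2 * (Nat.card K + 1) := by
    calc s.card ≤ 2 * (s.image x).card := by
          refine Finset.card_le_mul_card_image s 2 fun b hb => ?_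
          obtain ⟨Q, -, rfl⟩ := Finset.mem_image.1 hb
          refine (Finset.card_le_card (t := {Q, -Q}) fun R hR => ?_).trans Finset.card_le_two
          simpa using hx R Q (Finset.mem_filter.1 hR).2
      _ ≤ 2 * (Nat.card K + 1) := by
          rw [Nat.card_eq_fintype_card, ← Fintype.card_option]
          exact Nat.mul_le_mul_left 2 (Finset.card_le_univ _)
  have : Finite W.Point := by
    by_contra hinf
    rw [not_finite_iff_infinite] at hinf
    obtain ⟨s, hs⟩ := Infinite.exists_subset_card_eq W.Point (2 * (Nat.card K + 1) + 1)
    have := hfib s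
    omega
  have : Fintype W.Point := Fintype.ofFinite _
  exact addOrderOf_le_card_univ.trans (hfib Finset.univ)

end WeierstrassCurve.Affine.Point

namespace JacobianLadder

/-- The residue of an integer modulo `n`. -/
def residue (n : ℕ) (z : ℤ) : ℕ := (z % n).toNat

/-- Doubling modulo `n` on `y² = x³ + b` in Jacobian coordinates. -/
def double (n : ℕ) : ℕ × ℕ × ℕ → ℕ × ℕ × ℕ := fun (X, Y, Z) =>
  let X' := residue n (9 * X ^ 4 - 8 * X * Y ^ 2)
  (X', residue n (3 * X ^ 2 * (4 * X * Y ^ 2 - X') - 8 * Y ^ 4), residue n (2 * Y * Z))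

/-- Addition modulo `n` of the affine point `(x, y)` to a point in Jacobian coordinates. -/
def addAffine (n x y : ℕ) : ℕ × ℕ × ℕ → ℕ × ℕ × ℕ := fun (X, Y, Z) =>
  let H := residue n (x * Z ^ 2 - X)
  let R := residue n (y * Z ^ 3 - Y)
  let X' := residue n (R ^ 2 - H ^ 3 - 2 * X * H ^ 2)
  (X', residue n (R * (X * H ^ 2 - X') - Y * H ^ 3), residue n (Z * H))

/-- Double-and-add modulo `n` on `y² = x³ + b`, through the low `k` bits of `e`, where `(x, y)` is
the affine base point. -/
def ladder (n x y e : ℕ) : ℕ → ℕ × ℕ × ℕ → ℕ × ℕ × ℕ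
  | 0, T => T
  | k + 1, T =>
    let T' := cond (e.testBit k) (addAffine n x y (double n T)) (double n T)
    Nat.eager T'.1 fun X => Nat.eager T'.2.1 fun Y => Nat.eager T'.2.2 fun Z =>
      ladder n x y e k (X, Y, Z)

/-- Whether `(x, y)` is nonsingular with `e • (x, y) = -(x, y)` modulo every prime factor of `n`,
as tested on Jacobian coordinates, where `e` has `k + 1` bits. -/
def negates (n x y e k : ℕ) : Bool :=
  let T := ladder n x y e k (x, y, 1)
  e / 2 ^ k == 1 && Nat.gcd (2 * y) n == 1 && Nat.gcd T.2.2 n == 1 &&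
    residue n (T.1 - x * T.2.2 ^ 2) == 0 && residue n (T.2.1 + y * T.2.2 ^ 3) == 0

section Correctness

variable {K : Type*} [Field K] {n : ℕ}

theorem cast_residue (hn : n ≠ 0) (hnK : (n : K) = 0) (z : ℤ) : (residue n z : K) = z := by
  have h : ((residue n z : ℕ) : ℤ) = z % n := Int.toNat_of_nonneg (Int.emod_nonneg z (by omega))
  have h' : ((residue n z : ℤ) : K) = ((z % n + n * (z / n) : ℤ) : K) := by
    rw [h]; push_cast; rw [hnK, zero_mul, add_zero]
  rwa [Int.emod_add_mul_ediv, Int.cast_natCast] at h'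

/-- The curve `y² = x³ + b`. -/
abbrev curve (b : K) : WeierstrassCurve.Affine K := ⟨0, 0, 0, 0, b⟩

/-- The triple `T` represents the point `P` in Jacobian coordinates over `K`, unless its last
coordinate vanishes in `K`. -/
def Represents {b : K} (T : ℕ × ℕ × ℕ) (P : (curve b).Point) : Prop :=
  (T.2.2 : K) ≠ 0 → ∃ x y h, P = .some x y h ∧
    (T.1 : K) = x * (T.2.2 : K) ^ 2 ∧ (T.2.1 : K) = y * (T.2.2 : K) ^ 3

variable [DecidableEq K] {b : K} {T : ℕ × ℕ × ℕ} {P : (curve b).Point}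

theorem Represents.double (hn : n ≠ 0) (hnK : (n : K) = 0) (hT : Represents T P) :
    Represents (double n T) (P + P) := by
  obtain ⟨X, Y, Z⟩ := T
  intro hZ
  simp only [JacobianLadder.double, cast_residue hn hnK] at hZ ⊢
  push_cast at hZ ⊢
  simp only [cast_residue hn hnK]
  push_cast
  have hZ0 : (Z : K) ≠ 0 := right_ne_zero_of_mul hZ
  have hY0 : (2 * Y : K) ≠ 0 := left_ne_zero_of_mul hZ
  obtain ⟨x, y, h, rfl, hX, hY⟩ := hT hZ0
  simp only at hX hY
  have hy : (2 * y : K) ≠ 0 := by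
    intro h0
    apply hY0
    rw [hY, ← mul_assoc, h0, zero_mul]
  have hneg : y ≠ (curve b).negY x y := by
    intro h0
    apply hy
    simp only [WeierstrassCurve.Affine.negY] at h0
    linear_combination h0
  refine ⟨_, _, WeierstrassCurve.Affine.nonsingular_add h h fun hxy => hneg hxy.2,
    WeierstrassCurve.Affine.Point.add_self_of_Y_ne hneg, ?_⟩
  rw [WeierstrassCurve.Affine.slope_of_Y_ne rfl hneg]
  have hden : y - (curve b).negY x y = 2 * y := by
    simp only [WeierstrassCurve.Affine.negY]; ring
  rw [hden]
  have h2 : (2 : K) ≠ 0 := left_ne_zero_of_mul hy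
  have hy0 : y ≠ 0 := right_ne_zero_of_mul hy
  simp only [WeierstrassCurve.Affine.addX, WeierstrassCurve.Affine.addY,
    WeierstrassCurve.Affine.negAddY, WeierstrassCurve.Affine.negY, hX, hY]
  constructor
  · field_simp
    ring
  · field_simp
    ring

theorem Represents.addAffine (hn : n ≠ 0) (hnK : (n : K) = 0) {x y : ℕ}
    {h : (curve b).Nonsingular (x : K) (y : K)} (hT : Represents T P) :
    Represents (addAffine n x y T) (P + .some (x : K) (y : K) h) := by
  obtain ⟨X, Y, Z⟩ := T
  intro hZ
  simp only [JacobianLadder.addAffine, cast_residue hn hnK] at hZ ⊢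
  push_cast at hZ ⊢
  simp only [cast_residue hn hnK] at hZ ⊢
  push_cast at hZ ⊢
  simp only [cast_residue hn hnK]
  push_cast
  have hZ0 : (Z : K) ≠ 0 := left_ne_zero_of_mul hZ
  have hH0 : (x * Z ^ 2 - X : K) ≠ 0 := right_ne_zero_of_mul hZ
  obtain ⟨x', y', h', rfl, hX, hY⟩ := hT hZ0
  simp only at hX hY
  have hx : x' ≠ x := by
    rintro rfl
    exact hH0 (by rw [hX, sub_self])
  refine ⟨_, _, WeierstrassCurve.Affine.nonsingular_add h' h fun hxy => hx hxy.1,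
    WeierstrassCurve.Affine.Point.add_of_X_ne hx, ?_⟩
  rw [WeierstrassCurve.Affine.slope_of_X_ne hx]
  have hx0 : x' - x ≠ 0 := sub_ne_zero.2 hx
  simp only [WeierstrassCurve.Affine.addX, WeierstrassCurve.Affine.addY,
    WeierstrassCurve.Affine.negAddY, WeierstrassCurve.Affine.negY, hX, hY]
  constructor
  · field_simp
    ring
  · field_simp
    ring

theorem Represents.ladder (hn : n ≠ 0) (hnK : (n : K) = 0) {x y e : ℕ}
    {h : (curve b).Nonsingular (x : K) (y : K)} (k : ℕ) {T : ℕ × ℕ × ℕ}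
    (hT : Represents T ((e / 2 ^ k) • WeierstrassCurve.Affine.Point.some (x : K) (y : K) h)) :
    Represents (ladder n x y e k T)
      (e • WeierstrassCurve.Affine.Point.some (x : K) (y : K) h) := by
  induction k generalizing T with
  | zero => rwa [pow_zero, Nat.div_one] at hT
  | succ k ih =>
    simp only [JacobianLadder.ladder, Nat.eager_eq]
    apply ih
    rw [Nat.div_two_pow_eq_add_testBit]
    cases e.testBit k
    · simpa [add_nsmul] using hT.double hn hnK
    · simpa [add_nsmul] using (hT.double hn hnK).addAffine hn hnK

end Correctness

/-- The **Goldwasser–Kilian criterion** on the curve through `(x, y)` of the form `y² = x³ + b`. -/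
theorem prime_of_negates {n r : ℕ} (x y k : ℕ) (hn : 1 < n) (hr : r.Prime)
    (hnr : ∀ q, q ^ 2 ≤ n → 2 * (q + 1) < r) (h : negates n x y (r - 1) k = true) : n.Prime := by
  by_contra hnp
  set q := n.minFac with hq
  have : Fact q.Prime := ⟨Nat.minFac_prime hn.ne'⟩
  have hnK : (n : ZMod q) = 0 := (ZMod.natCast_eq_zero_iff _ _).2 (Nat.minFac_dvd n)
  have hn0 : n ≠ 0 := by omega
  have unit {m : ℕ} (hm : Nat.gcd m n = 1) : (m : ZMod q) ≠ 0 := fun h0 =>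
    (Fact.out : q.Prime).one_lt.ne' <| Nat.dvd_one.1 <|
      hm ▸ Nat.dvd_gcd ((ZMod.natCast_eq_zero_iff _ _).1 h0) (Nat.minFac_dvd n)
  simp only [negates, Bool.and_eq_true, beq_iff_eq] at h
  obtain ⟨⟨⟨⟨he, hy⟩, hZ⟩, hX⟩, hY⟩ := h
  let b : ZMod q := (y : ZMod q) ^ 2 - (x : ZMod q) ^ 3
  have hP : (curve b).Nonsingular (x : ZMod q) (y : ZMod q) := by
    rw [WeierstrassCurve.Affine.nonsingular_iff, WeierstrassCurve.Affine.equation_iff]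
    refine ⟨by simp only [b]; ring, .inr fun h0 => unit hy ?_⟩
    push_cast
    simp only at h0
    linear_combination h0
  let P : (curve b).Point := .some _ _ hP
  have hbase : Represents (x, y, 1) (((r - 1) / 2 ^ k) • P) := by
    rw [he, one_nsmul]
    exact fun _ => ⟨_, _, hP, rfl, by simp, by simp⟩
  obtain ⟨x', y', h', heq, hX', hY'⟩ := hbase.ladder hn0 hnK k (unit hZ)
  have hX0 := cast_residue hn0 hnK (((ladder n x y (r - 1) k (x, y, 1)).1 : ℤ) -
    x * ((ladder n x y (r - 1) k (x, y, 1)).2.2 : ℤ) ^ 2)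
  have hY0 := cast_residue hn0 hnK (((ladder n x y (r - 1) k (x, y, 1)).2.1 : ℤ) +
    y * ((ladder n x y (r - 1) k (x, y, 1)).2.2 : ℤ) ^ 3)
  rw [hX] at hX0
  rw [hY] at hY0
  push_cast at hX0 hY0
  rw [hX', ← sub_mul] at hX0
  rw [hY', ← add_mul] at hY0
  have hx : x' = x := sub_eq_zero.1
    ((mul_eq_zero.1 hX0.symm).resolve_right (pow_ne_zero _ (unit hZ)))
  have hy' : y' = -y := eq_neg_of_add_eq_zero_left
    ((mul_eq_zero.1 hY0.symm).resolve_right (pow_ne_zero _ (unit hZ)))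
  subst hx hy'
  have hneg : (r - 1) • P = -P := by
    rw [heq, WeierstrassCurve.Affine.Point.neg_some]
    simp [WeierstrassCurve.Affine.negY]
  have hrP : r • P = 0 := by
    rw [← Nat.sub_add_cancel hr.one_lt.le, succ_nsmul, hneg, neg_add_cancel]
  have : Fact r.Prime := ⟨hr⟩
  have hord : addOrderOf P = r :=
    addOrderOf_eq_prime hrP (WeierstrassCurve.Affine.Point.some_ne_zero hP)
  have hle := WeierstrassCurve.Affine.Point.addOrderOf_le P
  rw [hord, Nat.card_zmod] at hle
  exact hle.not_gt (hnr q (Nat.minFac_sq_le_self (by omega) hnp))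

end JacobianLadder

theorem prime_k9_r_pred_factor : Nat.Prime 26602664520936929631060097 := by
  have hF : 2 ^ 7 * 3 ^ 2 * 11 * 29 * 43 * 2341 * 31153 ∣ 26602664520936929631060097 - 1 := by
    norm_num
  refine Nat.prime_of_pocklington 5 (by norm_num) hF (by norm_num) ?_ fun l hl hlF => ?_
  · rw [Nat.pow_mod_eq_powMod 85 (by norm_num)]
    decide +kernel
  have h : l = 2 ∨ l = 3 ∨ l = 11 ∨ l = 29 ∨ l = 43 ∨ l = 2341 ∨ l = 31153 := by
    simp only [hl.dvd_mul] at hlF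
    rcases hlF with (((((h | h) | h) | h) | h) | h) | h
    · simp [(Nat.prime_dvd_prime_iff_eq hl (by norm_num)).1 (hl.dvd_of_dvd_pow h)]
    · simp [(Nat.prime_dvd_prime_iff_eq hl (by norm_num)).1 (hl.dvd_of_dvd_pow h)]
    all_goals simp [(Nat.prime_dvd_prime_iff_eq hl (by norm_num)).1 h]
  rcases h with rfl | rfl | rfl | rfl | rfl | rfl | rfl <;>
    · rw [Nat.pow_mod_eq_powMod 85 (by norm_num)]
      decide +kernel

set_option exponentiation.threshold 400 in
theorem prime_k9_r : Nat.Prime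
    169440772426819274154778701260757423597114376011671712180533212939494849872257 := by
  have hF : 2 ^ 7 * 3 ^ 2 * 11 * 29 * 2341 * 31153 * 26602664520936929631060097 ∣
      169440772426819274154778701260757423597114376011671712180533212939494849872257 - 1 := by
    norm_num
  refine Nat.prime_of_pocklington 7 (by norm_num) hF (by norm_num) ?_ fun l hl hlF => ?_
  · rw [Nat.pow_mod_eq_powMod 257 (by norm_num)]
    decide +kernel
  have h : l = 2 ∨ l = 3 ∨ l = 11 ∨ l = 29 ∨ l = 2341 ∨ l = 31153 ∨
      l = 26602664520936929631060097 := by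
    simp only [hl.dvd_mul] at hlF
    rcases hlF with (((((h | h) | h) | h) | h) | h) | h
    · simp [(Nat.prime_dvd_prime_iff_eq hl (by norm_num)).1 (hl.dvd_of_dvd_pow h)]
    · simp [(Nat.prime_dvd_prime_iff_eq hl (by norm_num)).1 (hl.dvd_of_dvd_pow h)]
    · simp [(Nat.prime_dvd_prime_iff_eq hl (by norm_num)).1 h]
    · simp [(Nat.prime_dvd_prime_iff_eq hl (by norm_num)).1 h]
    · simp [(Nat.prime_dvd_prime_iff_eq hl (by norm_num)).1 h]
    · simp [(Nat.prime_dvd_prime_iff_eq hl (by norm_num)).1 h]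
    · simp [(Nat.prime_dvd_prime_iff_eq hl prime_k9_r_pred_factor).1 h]
  rcases h with rfl | rfl | rfl | rfl | rfl | rfl | rfl <;>
    · rw [Nat.pow_mod_eq_powMod 257 (by norm_num)]
      decide +kernel

theorem prime_k9_p : Nat.Prime
    13522728075112739330542203653103566043035377929488752721485580527333685820130434460157787867627959369857 := by
  refine JacobianLadder.prime_of_negates
    8095666815775763041686676056169478693927504300702647112492181880018572363886849112476430783311379616778
    8721932509366832013695925939253388529445145730443124242893803568041607586244860700828035907821613589120
    256 (by norm_num) prime_k9_r (fun q hq => ?_) (by decide +kernel)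
  have hq' : q < 2 ^ 172 := lt_of_pow_lt_pow_left₀ 2 (by positivity) (hq.trans_lt (by norm_num))
  omega

set_option exponentiation.threshold 400 in
theorem k9_seed_parameters :
    let x₀ : ℕ := 2 ^ 43 + 2 ^ 37 + 2 ^ 7 + 1
    let r₀ : ℕ := (x₀ ^ 6 + x₀ ^ 3 + 1) / 3
    let p₀ : ℕ := (3 * (x₀ + 1) ^ 2 + (x₀ - 1) ^ 2 * (2 * x₀ ^ 3 + 1) ^ 2) / 12
    r₀.Prime ∧ 2 ^ 256 ≤ r₀ ∧ r₀ < 2 ^ 257 ∧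
    p₀.Prime ∧ 2 ^ 342 ≤ p₀ ∧ p₀ < 2 ^ 343 ∧
    p₀ % 6 = 1 ∧ x₀ % 6 = 1 := by
  intro x₀ r₀ p₀
  have hr : r₀ =
      169440772426819274154778701260757423597114376011671712180533212939494849872257 := by
    norm_num [r₀, x₀]
  have hp : p₀ =
      13522728075112739330542203653103566043035377929488752721485580527333685820130434460157787867627959369857 := by
    norm_num [p₀, x₀]
  rw [hr, hp]
  refine ⟨prime_k9_r, by norm_num, by norm_num, prime_k9_p, by norm_num, by norm_num, by norm_num,
    by norm_num [x₀]⟩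
end

section
/- Let x₀ = 2⁴⁸ + 2⁴¹ + 2⁹ + 2⁸ + 1. Then r₀ = x₀⁸ − x₀⁷ + x₀⁵ − x₀⁴ + x₀³ − x₀ + 1 is a prime number with 2³⁸⁴ ≤ r₀ < 2³⁸⁵, and p₀ = (x₀¹² − 2x₀¹¹ + x₀¹⁰ + x₀⁷ − 2x₀⁶ + x₀⁵ + x₀² + x₀ + 1)/3 is a prime number with 2⁵⁷⁴ ≤ p₀ < 2⁵⁷⁵; moreover p₀ ≡ 1 (mod 5). -/
/-- `evalThen n f` is `f n`, with `n` reduced to a numeral before `f` is applied to it. -/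
def evalThen {α : Type*} (n : ℕ) (f : ℕ → α) : α :=
  match n with
  | 0 => f 0
  | k + 1 => f (k + 1)

theorem evalThen_eq {α : Type*} (n : ℕ) (f : ℕ → α) : evalThen n f = f n := by
  cases n <;> rfl

/-- `powMod N s a e` computes `a ^ e % N` by repeated squaring, reading `s` binary digits of `e`. -/
def powMod (N : ℕ) : ℕ → ℕ → ℕ → ℕ
  | 0, _, _ => 1 % N
  | s + 1, a, e => evalThen (a * a % N) fun b ↦ evalThen (e / 2) fun d ↦
      a ^ (e % 2) * powMod N s b d % N

theorem powMod_eq (N : ℕ) {s a e : ℕ} (he : e < 2 ^ s) : powMod N s a e = a ^ e % N := by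
  induction s generalizing a e with
  | zero =>
    obtain rfl : e = 0 := by simpa using he
    simp [powMod]
  | succ s ih =>
    rw [powMod, evalThen_eq, evalThen_eq, ih (by rw [pow_succ] at he; omega)]
    conv_rhs => rw [← Nat.mod_add_div e 2, pow_add, pow_mul, pow_two]
    rw [Nat.mul_mod_mod]
    exact ((Nat.mod_modEq (a * a) N).pow (e / 2)).mul_left _

theorem prime_pow_dvd_of_dvd_of_not_dvd_div {n d P k : ℕ} (hP : P.Prime) (hk : P ^ k ∣ n)
    (hPn : P ∣ n) (hd : d ∣ n) (hnd : ¬ d ∣ n / P) : P ^ k ∣ d := by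
  obtain ⟨e, rfl⟩ := hd
  have he : ¬ P ∣ e := by
    rintro ⟨c, rfl⟩
    refine hnd ⟨c, ?_⟩
    rw [show d * (P * c) = P * (d * c) by ring, Nat.mul_div_cancel_left _ hP.pos]
  exact (Nat.Coprime.pow_left k ((Nat.Prime.coprime_iff_not_dvd hP).2 he)).dvd_of_dvd_mul_right hk

/-- Pocklington's criterion: every prime factor of `N` is `1` modulo the factored part `F`. -/
theorem dvd_prime_factor_sub_one {N F a q : ℕ} (hN : 1 < N) (hF : F ∣ N - 1)
    (hpow : a ^ (N - 1) % N = 1)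
    (hcop : ∀ P, P.Prime → P ∣ F → Nat.Coprime (a ^ ((N - 1) / P) % N + (N - 1)) N)
    (hq : q.Prime) (hqN : q ∣ N) : F ∣ q - 1 := by
  have : Fact q.Prime := ⟨hq⟩
  have cast_mod (m : ℕ) : ((m % N : ℕ) : ZMod q) = m :=
    (ZMod.natCast_eq_natCast_iff _ _ _).2 ((Nat.mod_modEq m N).of_dvd hqN)
  have hN0 : (N : ZMod q) = 0 := (ZMod.natCast_eq_zero_iff _ _).2 hqN
  have ha : (a : ZMod q) ^ (N - 1) = 1 := by
    have := cast_mod (a ^ (N - 1))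
    rw [hpow] at this
    simpa using this.symm
  have ha0 : (a : ZMod q) ≠ 0 := by
    intro h
    rw [h, zero_pow (by omega)] at ha
    exact zero_ne_one ha
  refine (Nat.dvd_iff_prime_pow_dvd_dvd _ _).2 fun P k hP hk ↦ ?_
  rcases Nat.eq_zero_or_pos k with rfl | hk0
  · simp
  have hPF : P ∣ F := (dvd_pow_self P hk0.ne').trans hk
  refine (prime_pow_dvd_of_dvd_of_not_dvd_div hP (hk.trans hF) (hPF.trans hF)
    (orderOf_dvd_of_pow_eq_one ha) fun h ↦ ?_).trans (ZMod.orderOf_dvd_card_sub_one ha0)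
  have h1 := orderOf_dvd_iff_pow_eq_one.1 h
  have h2 : q ∣ a ^ ((N - 1) / P) % N + (N - 1) := by
    rw [← ZMod.natCast_eq_zero_iff, Nat.cast_add, cast_mod, Nat.cast_pow, h1,
      Nat.cast_sub hN.le, hN0]
    simp
  exact hq.one_lt.ne' (Nat.dvd_one.1 ((hcop P hP hPF) ▸ Nat.dvd_gcd h2 hqN))

/-- A sufficient test, modulo the entries of `M`, for `s ^ 2 - 4 * t` not to be a square. -/
def nonsquareTest (M : List ℕ) (s t : ℕ) : Bool :=
  evalThen (s ^ 2) fun s ↦ M.any fun m ↦ evalThen (s % m) fun c ↦ evalThen (4 * t % m) fun b ↦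
    (List.range m).all fun i ↦ (i ^ 2 + b) % m != c

theorem ne_of_nonsquareTest {M : List ℕ} {s t : ℕ} (h : nonsquareTest M s t)
    (hM : ∀ m ∈ M, 0 < m) (d : ℕ) : d ^ 2 + 4 * t ≠ s ^ 2 := by
  simp only [nonsquareTest, evalThen_eq, List.any_eq_true, List.all_eq_true, List.mem_range,
    bne_iff_ne] at h
  obtain ⟨m, hm, h⟩ := h
  intro hd
  refine h (d % m) (Nat.mod_lt _ (hM m hm)) ?_
  rw [← hd]
  exact ((Nat.mod_modEq d m).pow 2).add (Nat.mod_modEq _ m)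

/-- A version of the Brillhart–Lehmer–Selfridge primality criterion. If `N = F * R + 1` is composite
then `N = (u * F + 1) * (v * F + 1)`, and the finitely many possible values of `u * v` are excluded
by quadratic residue conditions modulo the entries of `M`. -/
theorem prime_of_pocklington (F R a s K : ℕ) (L : List (ℕ × ℕ)) (M : List ℕ) {N : ℕ}
    (hN : N = F * R + 1) (hF : F = (L.map fun x ↦ x.1 ^ x.2).prod) (hF0 : 0 < F) (hR : 0 < R)
    (hs : N ≤ 2 ^ s) (hpow : powMod N s a (N - 1) = 1)
    (hL : ∀ x ∈ L, x.1.Prime)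
    (hcop : ∀ x ∈ L, Nat.Coprime (powMod N s a ((N - 1) / x.1) + (N - 1)) N)
    (hK : R / F < R / (F + 1) + K)
    (hM : (List.range K).all fun k ↦ evalThen (R / F - k) fun t ↦
      t == 0 || nonsquareTest M (R - t * F) t)
    (hM0 : ∀ m ∈ M, 0 < m) : N.Prime := by
  have hN1 : 1 < N := by have := Nat.mul_pos hF0 hR; omega
  have hFN : F ∣ N - 1 := ⟨R, by omega⟩
  rw [powMod_eq N (by omega)] at hpow
  by_contra hNp
  have key : ∀ q, q.Prime → q ∣ N → F ∣ q - 1 := fun q ↦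
    dvd_prime_factor_sub_one hN1 hFN hpow fun P hP hPF ↦ by
      rw [hF, hP.prime.dvd_prod_iff] at hPF
      obtain ⟨y, hy, hPy⟩ := hPF
      obtain ⟨x, hx, rfl⟩ := List.mem_map.1 hy
      obtain rfl := (Nat.prime_dvd_prime_iff_eq hP (hL x hx)).1 (hP.dvd_of_dvd_pow hPy)
      rw [← powMod_eq N (((N - 1).div_le_self _).trans_lt (by omega : N - 1 < 2 ^ s))]
      exact hcop x hx
  have hq := Nat.minFac_prime hN1.ne'
  obtain ⟨u, hu⟩ := key _ hq N.minFac_dvd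
  obtain ⟨m, hm⟩ := N.minFac_dvd
  set q := N.minFac
  have hq1 := hq.one_lt
  have hqu : q = F * u + 1 := by omega
  have hm1 : m ≠ 1 := by
    rintro rfl
    rw [mul_one] at hm
    exact hNp (hm ▸ hq)
  have hm0 : 0 < m := by
    rcases Nat.eq_zero_or_pos m with rfl | h
    · omega
    · exact h
  obtain ⟨v, hv⟩ : F ∣ m - 1 := by
    have h : N - 1 = F * (u * m) + (m - 1) := by
      rw [hm, hqu]
      have : (F * u + 1) * m = F * (u * m) + m := by ring
      omega
    exact (Nat.dvd_add_right (Dvd.intro _ rfl)).1 (h ▸ hFN)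
  have hmv : m = F * v + 1 := by omega
  have hu0 : 0 < u := Nat.pos_of_ne_zero fun h ↦ by simp [h] at hqu; omega
  have hv0 : 0 < v := Nat.pos_of_ne_zero fun h ↦ by simp [h] at hmv; omega
  have hRuv : R = u * v * F + (u + v) := by
    refine Nat.eq_of_mul_eq_mul_left hF0 ?_
    have : F * R + 1 = (F * u + 1) * (F * v + 1) := by rw [← hN, ← hqu, ← hmv, ← hm]
    nlinarith
  have huv : u + v ≤ u * v + 1 := by nlinarith
  have hle : u * v ≤ R / F := (Nat.le_div_iff_mul_le hF0).2 (by omega)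
  have hge : R / (F + 1) ≤ u * v := by
    refine Nat.lt_succ_iff.1 ((Nat.div_lt_iff_lt_mul (by omega)).2 ?_)
    rw [hRuv]
    have : (u * v).succ * (F + 1) = u * v * F + u * v + F + 1 := by rw [Nat.succ_eq_add_one]; ring
    omega
  have hkt : R / F - (R / F - u * v) = u * v := by omega
  have h := List.all_eq_true.1 hM (R / F - u * v) (List.mem_range.2 (by omega))
  rw [evalThen_eq, hkt, Bool.or_eq_true, beq_iff_eq, show R - u * v * F = u + v by omega] at h
  replace h := ne_of_nonsquareTest (h.resolve_left (Nat.mul_pos hu0 hv0).ne') hM0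
  rcases le_total u v with huv' | huv'
  · obtain ⟨d, rfl⟩ := Nat.exists_eq_add_of_le huv'
    exact h d (by ring)
  · obtain ⟨d, rfl⟩ := Nat.exists_eq_add_of_le huv'
    exact h d (by ring)

theorem prime_seed_order :
    Nat.Prime
      41933031483931929173872138167306456628506916051359945068680984192147211979589804423702853969731915081303589283302401 := by
  refine prime_of_pocklington
    226081187607339037379654898245904206580985787857228800
    185477756586991234405501136775769772120161873666088866857180823
    29 385 1
    [(2, 10), (3, 2), (5, 2), (7, 1), (47, 1), (53, 1), (271, 1), (4153, 1), (5783, 1),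
      (6211, 1), (14153, 1), (51343, 1), (54437, 1), (171043, 1), (285827, 1), (719833, 1)]
    [3] (by norm_num) (by norm_num) (by norm_num) (by norm_num)
    (by decide +kernel) (by decide +kernel) ?_ (by decide +kernel) (by norm_num) (by decide +kernel)
    (by decide +kernel)
  norm_num

theorem prime_281321107 : Nat.Prime 281321107 := by
  refine prime_of_pocklington
    209
    1346034
    2 29 32
    [(11, 1), (19, 1)]
    [3, 5, 7, 11, 13, 17, 19] (by norm_num) (by norm_num) (by norm_num) (by norm_num)
    (by decide +kernel) (by decide +kernel) ?_ (by decide +kernel) (by norm_num) (by decide +kernel)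
    (by decide +kernel)
  norm_num

theorem prime_1125284429 : Nat.Prime 1125284429 := by
  refine prime_of_pocklington
    281321107
    4
    2 31 1
    [(281321107, 1)]
    [] (by norm_num) (by norm_num) (by norm_num) (by norm_num)
    (by decide +kernel) (by decide +kernel) ?_ (by decide +kernel) (by norm_num) (by decide +kernel)
    (by decide +kernel)
  simp only [List.forall_mem_cons, List.not_mem_nil, IsEmpty.forall_iff, implies_true]
  exact ⟨prime_281321107, trivial⟩

theorem prime_53211701 : Nat.Prime 53211701 := by
  refine prime_of_pocklington
    100
    532117
    2 26 54
    [(2, 2), (5, 2)]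
    [3, 5, 7, 11, 13, 17, 19, 23, 29, 31] (by norm_num) (by norm_num) (by norm_num) (by norm_num)
    (by decide +kernel) (by decide +kernel) ?_ (by decide +kernel) (by norm_num) (by decide +kernel)
    (by decide +kernel)
  norm_num

theorem prime_6811097729 : Nat.Prime 6811097729 := by
  refine prime_of_pocklington
    53211701
    128
    2 33 1
    [(53211701, 1)]
    [] (by norm_num) (by norm_num) (by norm_num) (by norm_num)
    (by decide +kernel) (by decide +kernel) ?_ (by decide +kernel) (by norm_num) (by decide +kernel)
    (by decide +kernel)
  simp only [List.forall_mem_cons, List.not_mem_nil, IsEmpty.forall_iff, implies_true]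
  exact ⟨prime_53211701, trivial⟩

theorem prime_13622195459 : Nat.Prime 13622195459 := by
  refine prime_of_pocklington
    6811097729
    2
    2 34 1
    [(6811097729, 1)]
    [] (by norm_num) (by norm_num) (by norm_num) (by norm_num)
    (by decide +kernel) (by decide +kernel) ?_ (by decide +kernel) (by norm_num) (by decide +kernel)
    (by decide +kernel)
  simp only [List.forall_mem_cons, List.not_mem_nil, IsEmpty.forall_iff, implies_true]
  exact ⟨prime_6811097729, trivial⟩

theorem prime_559688782003850857247 : Nat.Prime 559688782003850857247 := by
  refine prime_of_pocklington
    3527461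
    158666185679686
    2 69 14
    [(7, 2), (193, 1), (373, 1)]
    [3, 5, 7] (by norm_num) (by norm_num) (by norm_num) (by norm_num)
    (by decide +kernel) (by decide +kernel) ?_ (by decide +kernel) (by norm_num) (by decide +kernel)
    (by decide +kernel)
  norm_num

theorem prime_seed_characteristic :
    Nat.Prime
      90513453509027837323015498966524467238615948271053123433025004142597079434172244878153242162500117528739179878419894291934572639098823619146067881891097102019540945709105921 := by
  refine prime_of_pocklington
    815305475066124824604074476067620205868801983407305688320
    111017840891706022293212726324240569949369606834949621423518515839840376553366649267572349566105473901194794562067431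
    11 575 168
    [(2, 8), (3, 2), (5, 1), (67, 1), (171043, 1), (719833, 1), (1125284429, 1),
      (13622195459, 1), (559688782003850857247, 1)]
    [3, 5, 7, 11, 13, 17, 19, 23, 29, 31] (by norm_num) (by norm_num) (by norm_num) (by norm_num)
    (by decide +kernel) (by decide +kernel) ?_ (by decide +kernel) (by norm_num) (by decide +kernel)
    (by decide +kernel)
  simp only [List.forall_mem_cons, List.not_mem_nil, IsEmpty.forall_iff, implies_true]
  exact ⟨by norm_num, by norm_num, by norm_num, by norm_num, by norm_num, by norm_num,
    prime_1125284429, prime_13622195459, prime_559688782003850857247, trivial⟩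

set_option exponentiation.threshold 600 in
theorem k15_seed_parameters :
    let x₀ : ℕ := 2 ^ 48 + 2 ^ 41 + 2 ^ 9 + 2 ^ 8 + 1
    let r₀ : ℕ := x₀ ^ 8 - x₀ ^ 7 + x₀ ^ 5 - x₀ ^ 4 + x₀ ^ 3 - x₀ + 1
    let p₀ : ℕ := (x₀ ^ 12 - 2 * x₀ ^ 11 + x₀ ^ 10 + x₀ ^ 7 - 2 * x₀ ^ 6 + x₀ ^ 5 +
      x₀ ^ 2 + x₀ + 1) / 3
    r₀.Prime ∧ 2 ^ 384 ≤ r₀ ∧ r₀ < 2 ^ 385 ∧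
    p₀.Prime ∧ 2 ^ 574 ≤ p₀ ∧ p₀ < 2 ^ 575 ∧
    p₀ % 5 = 1 := by
  intro x₀ r₀ p₀
  have hr : r₀ =
      41933031483931929173872138167306456628506916051359945068680984192147211979589804423702853969731915081303589283302401 := by
    norm_num [r₀, x₀]
  have hp : p₀ =
      90513453509027837323015498966524467238615948271053123433025004142597079434172244878153242162500117528739179878419894291934572639098823619146067881891097102019540945709105921 := by
    norm_num [p₀, x₀]
  rw [hr, hp]
  exact ⟨prime_seed_order, by norm_num, by norm_num, prime_seed_characteristic, by norm_num,
    by norm_num, by norm_num⟩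
end

section
/- Let x₀ = 2²⁹ + 2¹⁹ + 2¹⁷ + 2¹⁴. Then p₀ = (1/3)(x₀−1)²(x₀¹⁸ + x₀⁹ + 1) + x₀ is a prime number with 2⁵⁷⁸ ≤ p₀ < 2⁵⁷⁹, the value r₀ = (x₀¹⁸ + x₀⁹ + 1)/3 is an integer, and p₀ ≡ 1 (mod 3). -/
open WeierstrassCurve.Affine in
/-- In `y² = x³ + a x + b`, doubling of an affine point with nonzero second coordinate. -/
theorem shortWeierstrass_double {F : Type*} [Field F] [DecidableEq F] {a b x y x' y' l : F}
    (h : Nonsingular (⟨0, 0, 0, a, b⟩ : WeierstrassCurve F) x y) (hy : 2 * y ≠ 0)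
    (hl : l * (2 * y) = 3 * x ^ 2 + a) (hx' : x' = l ^ 2 - 2 * x) (hy' : y' = l * (x - x') - y) :
    ∃ h' : Nonsingular (⟨0, 0, 0, a, b⟩ : WeierstrassCurve F) x' y',
      Point.some x y h + Point.some x y h = Point.some x' y' h' := by
  have hne : y ≠ negY (⟨0, 0, 0, a, b⟩ : WeierstrassCurve F) x y := fun e => hy <| by
    simp only [negY, zero_mul, sub_zero] at e
    linear_combination e
  have hs : slope (⟨0, 0, 0, a, b⟩ : WeierstrassCurve F) x x y y = l := by
    rw [slope_of_Y_ne rfl hne, div_eq_iff (sub_ne_zero.2 hne)]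
    simp only [negY]
    linear_combination -hl
  have key := Point.add_self_of_Y_ne (h₁ := h) hne
  simp only [hs] at key
  have e1 : addX (⟨0, 0, 0, a, b⟩ : WeierstrassCurve F) x x l = x' := by
    rw [hx', addX]; ring
  have e2 : addY (⟨0, 0, 0, a, b⟩ : WeierstrassCurve F) x x y l = y' := by
    rw [addY, negAddY, e1, negY, hy']; ring
  simp only [e1, e2] at key
  exact ⟨_, key⟩

open WeierstrassCurve.Affine in
/-- In `y² = x³ + a x + b`, addition of two affine points with distinct first coordinates. -/
theorem shortWeierstrass_add {F : Type*} [Field F] [DecidableEq F] {a b x₁ y₁ x₂ y₂ x' y' l : F}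
    (h₁ : Nonsingular (⟨0, 0, 0, a, b⟩ : WeierstrassCurve F) x₁ y₁)
    (h₂ : Nonsingular (⟨0, 0, 0, a, b⟩ : WeierstrassCurve F) x₂ y₂) (hx : x₁ ≠ x₂)
    (hl : l * (x₁ - x₂) = y₁ - y₂) (hx' : x' = l ^ 2 - x₁ - x₂) (hy' : y' = l * (x₁ - x') - y₁) :
    ∃ h' : Nonsingular (⟨0, 0, 0, a, b⟩ : WeierstrassCurve F) x' y',
      Point.some x₁ y₁ h₁ + Point.some x₂ y₂ h₂ = Point.some x' y' h' := by
  have hs : slope (⟨0, 0, 0, a, b⟩ : WeierstrassCurve F) x₁ x₂ y₁ y₂ = l := by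
    rw [slope_of_X_ne hx, div_eq_iff (sub_ne_zero.2 hx), hl]
  have key := Point.add_of_X_ne (h₁ := h₁) (h₂ := h₂) hx
  simp only [hs] at key
  have e1 : addX (⟨0, 0, 0, a, b⟩ : WeierstrassCurve F) x₁ x₂ l = x' := by
    rw [hx', addX]; ring
  have e2 : addY (⟨0, 0, 0, a, b⟩ : WeierstrassCurve F) x₁ x₂ y₁ l = y' := by
    rw [addY, negAddY, e1, negY, hy']; ring
  simp only [e1, e2] at key
  exact ⟨_, key⟩

/-- Application of `f` to `v` through the recursor of `ℕ`, which makes the kernel evaluate `v` to a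
literal first. -/
def applyEvaluated {α : Type*} (v : ℕ) (f : ℕ → α) : α :=
  Nat.rec (f 0) (fun k _ => f (k + 1)) v

theorem applyEvaluated_eq {α : Type*} (v : ℕ) (f : ℕ → α) : applyEvaluated v f = f v := by
  cases v <;> rfl

/-- Doubling in Jacobian coordinates modulo `n` on `y² = x³ + a x + b`. -/
def jacobianDouble (n a : ℕ) (s : ℕ × ℕ × ℕ) : ℕ × ℕ × ℕ :=
  applyEvaluated (4 * s.1 * s.2.1 ^ 2 % n) fun S =>
  applyEvaluated ((3 * s.1 ^ 2 + a * s.2.2 ^ 4) % n) fun M =>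
  applyEvaluated ((M ^ 2 + (n - 1) * (2 * S)) % n) fun X =>
  applyEvaluated ((M * (S + (n - 1) * X) + (n - 1) * (8 * s.2.1 ^ 4)) % n) fun Y =>
  applyEvaluated (2 * s.2.1 * s.2.2 % n) fun Z => (X, Y, Z)

/-- Addition of the affine point `(x, y)` in Jacobian coordinates modulo `n`. -/
def jacobianAdd (n x y : ℕ) (s : ℕ × ℕ × ℕ) : ℕ × ℕ × ℕ :=
  applyEvaluated ((x * s.2.2 ^ 2 + (n - 1) * s.1) % n) fun H =>
  applyEvaluated ((y * s.2.2 ^ 3 + (n - 1) * s.2.1) % n) fun R =>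
  applyEvaluated ((R ^ 2 + (n - 1) * (H ^ 3 + 2 * s.1 * H ^ 2)) % n) fun X =>
  applyEvaluated ((R * (s.1 * H ^ 2 + (n - 1) * X) + (n - 1) * (s.2.1 * H ^ 3)) % n) fun Y =>
  applyEvaluated (s.2.2 * H % n) fun Z => (X, Y, Z)

/-- Double-and-add over the lowest `i` bits of `k`, starting from `s`. -/
def jacobianLadder (n a x y k : ℕ) : ℕ → ℕ × ℕ × ℕ → ℕ × ℕ × ℕ
  | 0, s => s
  | i + 1, s =>
    match jacobianDouble n a s with
    | (X, Y, Z) =>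
      match k / 2 ^ i % 2 with
      | 0 => jacobianLadder n a x y k i (X, Y, Z)
      | _ + 1 =>
        match jacobianAdd n x y (X, Y, Z) with
        | (X', Y', Z') => jacobianLadder n a x y k i (X', Y', Z')

/-- The triple `s` of Jacobian coordinates describes the point `P`, unless its last entry
vanishes. -/
def JacobianRepresents {F : Type*} [Field F] {a b : F}
    (P : WeierstrassCurve.Affine.Point (⟨0, 0, 0, a, b⟩ : WeierstrassCurve F))
    (s : ℕ × ℕ × ℕ) : Prop :=
  (s.2.2 : F) ≠ 0 → ∃ h, P = .some ((s.1 : F) / (s.2.2 : F) ^ 2) ((s.2.1 : F) / (s.2.2 : F) ^ 3) h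

theorem cast_mod_of_cast_eq_zero {F : Type*} [Field F] {n : ℕ} (hn : (n : F) = 0) (m : ℕ) :
    ((m % n : ℕ) : F) = m := by
  conv_rhs => rw [← Nat.mod_add_div m n]
  simp [hn]

theorem cast_pred_of_cast_eq_zero {F : Type*} [Field F] {n : ℕ} (hn : (n : F) = 0) (hpos : 0 < n) :
    ((n - 1 : ℕ) : F) = -1 := by
  rw [Nat.cast_pred hpos, hn, zero_sub]

section

variable {F : Type*} [Field F] [DecidableEq F] {n a : ℕ} {b : F}

theorem JacobianRepresents.double (hn : (n : F) = 0) (hpos : 0 < n)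
    {P : WeierstrassCurve.Affine.Point (⟨0, 0, 0, (a : F), b⟩ : WeierstrassCurve F)}
    {s : ℕ × ℕ × ℕ} (hs : JacobianRepresents P s) :
    JacobianRepresents (P + P) (jacobianDouble n a s) := by
  obtain ⟨X, Y, Z⟩ := s
  intro hZ'
  simp only [jacobianDouble, applyEvaluated_eq, cast_mod_of_cast_eq_zero hn, Nat.cast_add,
    Nat.cast_mul, Nat.cast_pow, cast_pred_of_cast_eq_zero hn hpos, Nat.cast_ofNat] at hZ' ⊢
  have hZ : (Z : F) ≠ 0 := right_ne_zero_of_mul hZ'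
  have hY : (Y : F) ≠ 0 := right_ne_zero_of_mul (left_ne_zero_of_mul hZ')
  have h2 : (2 : F) ≠ 0 := left_ne_zero_of_mul (left_ne_zero_of_mul hZ')
  obtain ⟨h, rfl⟩ := hs hZ
  refine shortWeierstrass_double h (l := (3 * (X : F) ^ 2 + a * (Z : F) ^ 4) / (2 * Y * Z))
    (mul_ne_zero h2 (div_ne_zero hY (pow_ne_zero 3 hZ))) ?_ ?_ ?_
  all_goals
    dsimp only
    field_simp
    try ring

theorem JacobianRepresents.add (hn : (n : F) = 0) (hpos : 0 < n) {x y : ℕ}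
    {P : WeierstrassCurve.Affine.Point (⟨0, 0, 0, (a : F), b⟩ : WeierstrassCurve F)}
    (h₀ : WeierstrassCurve.Affine.Nonsingular
      (⟨0, 0, 0, (a : F), b⟩ : WeierstrassCurve F) (x : F) (y : F))
    {s : ℕ × ℕ × ℕ} (hs : JacobianRepresents P s) :
    JacobianRepresents (P + .some _ _ h₀) (jacobianAdd n x y s) := by
  obtain ⟨X, Y, Z⟩ := s
  intro hZ'
  simp only [jacobianAdd, applyEvaluated_eq, cast_mod_of_cast_eq_zero hn, Nat.cast_add,
    Nat.cast_mul, Nat.cast_pow, cast_pred_of_cast_eq_zero hn hpos, Nat.cast_ofNat] at hZ' ⊢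
  have hZ : (Z : F) ≠ 0 := left_ne_zero_of_mul hZ'
  obtain ⟨h, rfl⟩ := hs hZ
  obtain ⟨H, hH_def⟩ : ∃ H, (x : F) * (Z : F) ^ 2 + -1 * X = H := ⟨_, rfl⟩
  have hH : H ≠ 0 := hH_def ▸ right_ne_zero_of_mul hZ'
  have hx : (x : F) = (H + X) / (Z : F) ^ 2 := by
    rw [eq_div_iff (pow_ne_zero 2 hZ)]
    linear_combination hH_def
  refine shortWeierstrass_add h h₀ (l := ((y : F) * (Z : F) ^ 3 + -1 * Y) / (Z * H)) ?_ ?_ ?_ ?_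
  · intro e
    rw [div_eq_iff (pow_ne_zero 2 hZ)] at e
    exact hH (by linear_combination -hH_def - e)
  all_goals
    simp only [hH_def]
    try rw [hx]
    field_simp
    ring

theorem JacobianRepresents.ladder (hn : (n : F) = 0) (hpos : 0 < n) {x y : ℕ}
    (h₀ : WeierstrassCurve.Affine.Nonsingular
      (⟨0, 0, 0, (a : F), b⟩ : WeierstrassCurve F) (x : F) (y : F)) (k i : ℕ) :
    ∀ {m : ℕ} {s : ℕ × ℕ × ℕ},
    JacobianRepresents (m • WeierstrassCurve.Affine.Point.some _ _ h₀) s →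
    JacobianRepresents ((m * 2 ^ i + k % 2 ^ i) • WeierstrassCurve.Affine.Point.some _ _ h₀)
      (jacobianLadder n a x y k i s) := by
  induction i with
  | zero => intro m s hs; simpa [Nat.mod_one, jacobianLadder] using hs
  | succ i ih =>
    intro m s hs
    have hd := hs.double hn hpos
    rw [← add_nsmul] at hd
    simp only [jacobianLadder]
    rw [Nat.mod_pow_succ]
    split
    · rename_i e
      convert ih hd using 2
      rw [e]; ring
    · rename_i j e
      have hj : k / 2 ^ i % 2 = 1 := by omega
      have ha := hd.add hn hpos h₀
      rw [← succ_nsmul] at ha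
      convert ih ha using 2
      rw [hj]; ring

end

open WeierstrassCurve.Affine in
/-- Over a field with `q` elements, every point of a Weierstrass curve has order at most
`2 (q + 1)`, since at most two points share their first coordinate. -/
theorem addOrderOf_point_le {F : Type*} [Field F] [Fintype F] [DecidableEq F] {W : WeierstrassCurve F}
    (P : W.toAffine.Point) : addOrderOf P ≤ 2 * (Fintype.card F + 1) := by
  classical
  let T : Finset (Fin 2 → F) := insert ![1, 0] (Finset.univ.image fun x : F => ![x, 1])
  have hT : T.card ≤ Fintype.card F + 1 :=
    (Finset.card_insert_le _ _).trans (Nat.succ_le_succ Finset.card_image_le)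
  have hmaps : ∀ k ∈ Finset.range (addOrderOf P), (k • P).xRep ∈ T := by
    intro k _
    rcases k • P with _ | ⟨x, y, h⟩
    · exact Finset.mem_insert_self _ _
    · exact Finset.mem_insert_of_mem (Finset.mem_image_of_mem _ (Finset.mem_univ x))
  have hfib : ∀ c ∈ T, ((Finset.range (addOrderOf P)).filter fun k => (k • P).xRep = c).card ≤
      2 := by
    intro c _
    rcases Finset.eq_empty_or_nonempty
      ((Finset.range (addOrderOf P)).filter fun k => (k • P).xRep = c) with he | ⟨k₀, hk₀⟩
    · simp [he]
    · rw [Finset.mem_filter] at hk₀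
      refine (Finset.card_le_card_of_injOn (t := {k₀ • P, -(k₀ • P)}) (fun k => k • P) ?_ ?_).trans
        Finset.card_le_two
      · intro k hk
        have hk := (Finset.mem_filter.1 hk).2
        simpa using Point.eq_or_eq_neg_of_xRep_eq_xRep (hk.trans hk₀.2.symm)
      · intro k hk l hl e
        have hk := Finset.mem_range.1 (Finset.mem_filter.1 hk).1
        have hl := Finset.mem_range.1 (Finset.mem_filter.1 hl).1
        exact nsmul_injOn_Iio_addOrderOf hk hl e
  calc addOrderOf P = (Finset.range (addOrderOf P)).card := (Finset.card_range _).symm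
    _ ≤ 2 * T.card := Finset.card_le_mul_card_image_of_maps_to hmaps 2 hfib
    _ ≤ _ := Nat.mul_le_mul_left 2 hT

/-- The computation certifying that `(x, y)` has order dividing `r` modulo every prime factor of
`n`, on the curve `y² = x³ + a x + b` through it. -/
def ellipticCheck (n r a x y : ℕ) : Bool :=
  (r - 1) / 2 ^ (r - 1).log2 == 1 && 4 * n < (r - 2) ^ 2 && 1 < n && (2 * y).gcd n == 1 &&
  match jacobianLadder n a x y (r - 1) (r - 1).log2 (x, y, 1) with
  | (X, Y, Z) => Z.gcd n == 1 && (x * Z ^ 2) % n == X % n && (Y + y * Z ^ 3) % n == 0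

open WeierstrassCurve.Affine in
/-- The Goldwasser–Kilian primality criterion. -/
theorem Nat.Prime.of_ellipticCheck {n r a x y : ℕ} (hr : r.Prime)
    (hc : ellipticCheck n r a x y = true) : n.Prime := by
  have hr1 : 1 ≤ r := hr.one_le
  simp only [ellipticCheck, Bool.and_eq_true, beq_iff_eq, decide_eq_true_eq] at hc
  obtain ⟨⟨⟨⟨hlog, hsize⟩, hn1⟩, hy⟩, hc⟩ := hc
  generalize hs : jacobianLadder n a x y (r - 1) (r - 1).log2 (x, y, 1) = s at hc
  obtain ⟨X, Y, Z⟩ := s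
  obtain ⟨⟨hZ, hX⟩, hY⟩ := hc
  by_contra hn
  have hpos : 0 < n := by omega
  set q := n.minFac
  have hqp : q.Prime := Nat.minFac_prime hn1.ne'
  have : Fact q.Prime := ⟨hqp⟩
  have hqn : q ^ 2 ≤ n := Nat.minFac_sq_le_self hpos hn
  have hdvd : q ∣ n := Nat.minFac_dvd n
  have hn0 : (n : ZMod q) = 0 := (ZMod.natCast_eq_zero_iff _ _).2 hdvd
  have unit_of_gcd : ∀ {m : ℕ}, m.gcd n = 1 → (m : ZMod q) ≠ 0 := fun {m} h e =>
    hqp.one_lt.ne' (Nat.dvd_one.1 (h ▸ Nat.dvd_gcd ((ZMod.natCast_eq_zero_iff _ _).1 e) hdvd))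
  have hZ0 := unit_of_gcd hZ
  have hy0 := unit_of_gcd hy
  have hX0 : (x : ZMod q) * (Z : ZMod q) ^ 2 = X := by
    have := congrArg (Nat.cast (R := ZMod q)) hX
    simpa [cast_mod_of_cast_eq_zero hn0] using this
  have hY0 : (Y : ZMod q) + y * (Z : ZMod q) ^ 3 = 0 := by
    have := congrArg (Nat.cast (R := ZMod q)) hY
    simpa [cast_mod_of_cast_eq_zero hn0] using this
  let b : ZMod q := y ^ 2 - x ^ 3 - a * x
  have h₀ : Nonsingular (⟨0, 0, 0, (a : ZMod q), b⟩ : WeierstrassCurve (ZMod q)) x y := by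
    rw [nonsingular_iff, equation_iff]
    refine ⟨by simp only [b]; ring, Or.inr fun e => ?_⟩
    exact hy0 (by push_cast; linear_combination e)
  let P : Point (⟨0, 0, 0, (a : ZMod q), b⟩ : WeierstrassCurve (ZMod q)) := .some _ _ h₀
  have hinit : JacobianRepresents (1 • P) (x, y, 1) := fun _ => by
    simp only [one_nsmul, Nat.cast_one, one_pow, div_one]
    exact ⟨h₀, rfl⟩
  have hfin := hinit.ladder hn0 hpos h₀ (r - 1) (r - 1).log2
  have hk : 1 * 2 ^ (r - 1).log2 + (r - 1) % 2 ^ (r - 1).log2 = r - 1 := by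
    have := Nat.div_add_mod (r - 1) (2 ^ (r - 1).log2)
    rw [hlog] at this
    omega
  rw [hk, hs] at hfin
  obtain ⟨h', e'⟩ := hfin hZ0
  have hneg : (r - 1) • P = -P := by
    refine e'.trans ?_
    simp only [P, Point.neg_some, Point.some.injEq, negY]
    constructor
    · rw [← hX0]; field_simp
    · rw [div_eq_iff (pow_ne_zero 3 hZ0)]
      linear_combination hY0
  have hrP : r • P = 0 := by
    conv_lhs => rw [← Nat.sub_add_cancel hr1]
    rw [succ_nsmul, hneg, neg_add_cancel]
  have : Fact r.Prime := ⟨hr⟩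
  have hle := addOrderOf_point_le P
  rw [addOrderOf_eq_prime hrP (Point.some_ne_zero h₀), ZMod.card] at hle
  have h1 : (r - 2) ^ 2 ≤ (2 * q) ^ 2 := Nat.pow_le_pow_left (by omega) 2
  rw [mul_pow] at h1
  omega

theorem prime_39_bits :
    Nat.Prime 311305665787 :=
  .of_ellipticCheck (r := 6550639)
    (a := 0)
    (x := 237989048064)
    (y := 200620452331)
    (by norm_num) (by decide +kernel)

theorem prime_66_bits :
    Nat.Prime 68430176348029000711 :=
  .of_ellipticCheck (r := 311305665787)
    (a := 0)
    (x := 57416055443245124703)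
    (y := 56100738961559621100)
    prime_39_bits (by decide +kernel)

theorem prime_101_bits :
    Nat.Prime 2182824056965356427287346673911 :=
  .of_ellipticCheck (r := 68430176348029000711)
    (a := 2073531377548023735782515546270)
    (x := 697345338351976301202114693668)
    (y := 1459785068147427660033626644662)
    prime_66_bits (by decide +kernel)

theorem prime_139_bits :
    Nat.Prime 383597254966336600757856441303870980916889 :=
  .of_ellipticCheck (r := 2182824056965356427287346673911)
    (a := 0)
    (x := 169112578186625122788718887154023868252313)
    (y := 168209685326273200179511063914150280338592)
    prime_101_bits (by decide +kernel)

theorem prime_174_bits :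
    Nat.Prime 20829465913366237326684581396984422272353776405245917 :=
  .of_ellipticCheck (r := 383597254966336600757856441303870980916889)
    (a := 14496179804343945667941060176836179803999312674804129)
    (x := 18175360417417469045285430874485940444241756330815369)
    (y := 2009320946773656588584145214395274136454720149117785)
    prime_139_bits (by decide +kernel)

theorem prime_220_bits :
    Nat.Prime 1524509503372230595153603034859733980723898226583112452558051546179 :=
  .of_ellipticCheck (r := 20829465913366237326684581396984422272353776405245917)
    (a := 527144187455827178640873100142248933759324046963217395986705796802)
    (x := 61399852470071942002754895658926309078174801423510296542126687978)
    (y := 784272364898229678624285482115838424636692099059805126879406985961)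
    prime_174_bits (by decide +kernel)

theorem prime_262_bits :
    Nat.Prime 3770376397223892245106020597932351663165287165178305008023339074556396653739681 :=
  .of_ellipticCheck (r := 1524509503372230595153603034859733980723898226583112452558051546179)
    (a := 818861284754935399425472435279754015784415340098115843304188001527172588403383)
    (x := 3658704711753132138470416247214911259599163402218458985544675518375686822115903)
    (y := 1390074717037252968372463675304559547030243755978468797612373011888000486142722)
    prime_220_bits (by decide +kernel)

theorem prime_294_bits :
    Nat.Prime 22475970237416477441503753797519764586354194224427813265328177711461334378345057704120229 :=
  .of_ellipticCheck (r := 3770376397223892245106020597932351663165287165178305008023339074556396653739681)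
    (a := 5260189617061137954928734375285258409477248507668125112324222884244213288281749725662656)
    (x := 14489103397614839373586712761140911172773303294123873324134772794545516735957476478782712)
    (y := 19140277608557543193975781836844874111011064549022727796526962956232508990587847164717585)
    prime_262_bits (by decide +kernel)

theorem prime_322_bits :
    Nat.Prime 6035080958735643029078268985390613767752478762206162106669799388484636207643085362258504715303557 :=
  .of_ellipticCheck (r := 22475970237416477441503753797519764586354194224427813265328177711461334378345057704120229)
    (a := 246791585019633036688520486865765398899611278915767158238542291849504165530935624812629969184083)
    (x := 2504227819947792131341321233045789906041976689585666851792654034053391495989301959474250254677945)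
    (y := 1629129622173509440161576888089544761364734660745525993722600125619268770331660471443772638936380)
    prime_294_bits (by decide +kernel)

theorem prime_417_bits :
    Nat.Prime 224446071934456612895936310305378603478800936437162103418114520138159803363989443309127746504972140165571447840640693326667657 :=
  .of_ellipticCheck (r := 6035080958735643029078268985390613767752478762206162106669799388484636207643085362258504715303557)
    (a := 192742162265562440407424351261777536089103171522571662528816004061390264516692387014444970456517022206873477779288473819392329)
    (x := 165513756819636284805072838419575197376690798060116416706083226555305294477543988248998339069455941683743708025116917080759321)
    (y := 108714975874124419103189807777865196363333993834294510591750590357738823016624168011603512275710326632253593459686827194448389)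
    prime_322_bits (by decide +kernel)

theorem prime_450_bits :
    Nat.Prime 1947588435115242866769350805013486655217925658802763777735963233198299127519072271984513681037134385689712770128929031730076760477232807 :=
  .of_ellipticCheck (r := 224446071934456612895936310305378603478800936437162103418114520138159803363989443309127746504972140165571447840640693326667657)
    (a := 524874513247537811693728116280603301765960384813825465518473682774091376704361885752516463201977296493069270367788556132759766084261207)
    (x := 698655913823356308546823641490495268166707273797317076148049798245162067622331859867069959269563147880484891480593539777444745254606426)
    (y := 1195592556606577838656243388302061201093721994516279847266090525133119939615629097710431281523488644885919997793707177166209945543419795)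
    prime_417_bits (by decide +kernel)

theorem prime_475_bits :
    Nat.Prime 66180457288889235587686614286937886254696870792592251157388000557606107638477227954725785296804933851201350187751090930638529709282226673178577 :=
  .of_ellipticCheck (r := 1947588435115242866769350805013486655217925658802763777735963233198299127519072271984513681037134385689712770128929031730076760477232807)
    (a := 26446721908830793628295105049230876624667695204890042770463091006723162103064730398160915469841752845603357377373794989694409155535329274373235)
    (x := 43393393021797680994985266962315917281888028939418575704206507301470398682742252735759079907059879686013235288091544319325967615424561802896020)
    (y := 58611607885539266530934734614160660152731815820816975455890312216696794638383223116350724268443542581515136555589441351997925854891108423025838)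
    prime_450_bits (by decide +kernel)

theorem prime_499_bits :
    Nat.Prime 1448839513165429101129945807742901661986705097790352465953834399535255655583382155247633084716211424836450437802188866569277026596983643986624058572497 :=
  .of_ellipticCheck (r := 66180457288889235587686614286937886254696870792592251157388000557606107638477227954725785296804933851201350187751090930638529709282226673178577)
    (a := 1431022018367190620196688035235922860184818371554548161654885136233734217889498965257702598378699376987214337659679141374791371550941646532864953334587)
    (x := 17057576819550505705795326780555277387591343935872909335451970907045593257477584174771581826292097237960324841203799145915065235180651452804058044342)
    (y := 858547532787204041079960321051770317707955933622990022457727363235536391722841290347576352379240746247999802098949600868708111345888781681735126330915)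
    prime_475_bits (by decide +kernel)

theorem prime_514_bits :
    Nat.Prime 28715999150938804784395525909464310940576495038204785875204997798788767093662336489490067786372585141345162121605964996537083938709856119309021158216099417 :=
  .of_ellipticCheck (r := 1448839513165429101129945807742901661986705097790352465953834399535255655583382155247633084716211424836450437802188866569277026596983643986624058572497)
    (a := 4831476271779967307551276948354537982201397970390911125800609018823579878207706071187071010181277563100413146306295209775443740699595544838975649342369007)
    (x := 12484296210707351817256275688911216458824439218908844427137334315283712073450583400052457613868224595368014421801615261704246666234521107585429597268073478)
    (y := 6084216484682025858051783577026829651981135994226186156090469319464373014575484729419876172043491556624674622940670655412095981972026200367534237082085151)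
    prime_499_bits (by decide +kernel)

theorem k27_seed_parameters :
    let x₀ : ℕ := 2 ^ 29 + 2 ^ 19 + 2 ^ 17 + 2 ^ 14
    let p₀ : ℕ := (x₀ - 1) ^ 2 * (x₀ ^ 18 + x₀ ^ 9 + 1) / 3 + x₀
    p₀.Prime ∧ 2 ^ 578 ≤ p₀ ∧ p₀ < 2 ^ 579 ∧
    (3 : ℕ) ∣ x₀ ^ 18 + x₀ ^ 9 + 1 ∧
    p₀ % 3 = 1 := by
  intro x₀ p₀
  refine ⟨.of_ellipticCheck (a := 0)
    (x := 1324926873612435089799163577764480469245992837676862785984110903660609495233260853607898369725699250788160752761478267047005049491414009387370657487303867782644589246198521993)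
    (y := 34374728980096335920048220507188845159558338100845506764472619127748989720552916480670364281813162494609057226670894571870028344024521671922792110133277262372070739738878358)
    prime_514_bits (by decide +kernel), ?_⟩
  decide +kernel
end
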